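/- Let α be irrational with 0 < α < 1, and let 0 < β < 1 be such that there are no integers q ≥ 1 and p with β = qα − p. Then M₊(α,β) = min( liminf_{n→∞} λ_n(β), liminf_{n→∞} ρ_n(β) ). -/

import Mathlib

open Filter Finset

/-- Distance from `x` to the nearest integer. -/
noncomputable def nint (x : ℝ) : ℝ := |x - (round x : ℝ)|

/-- One-sided inhomogeneous approximation constant
`M₊(α,β) = liminf_{q→∞} q‖qα−β‖` over positive integers `q`. -/
noncomputable def Mplus (α β : ℝ) : ℝ :=
  Filter.liminf (fun q : ℕ => (q : ℝ) * nint (q * α - β)) Filter.atTop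

/-- Complete quotients of the negative continued fraction: `ncq α i = α_{i+1}`,
so `ncq α 0 = α₁ = α` and `α_{i+1} = a_i - 1/α_i` with `a_i = ⌈1/α_i⌉`. -/
noncomputable def ncq (α : ℝ) : ℕ → ℝ
  | 0 => α
  | i + 1 => (⌈(ncq α i)⁻¹⌉ : ℝ) - (ncq α i)⁻¹

/-- Partial quotients of the negative continued fraction: `npq α i = a_i = ⌈1/α_i⌉` for `i ≥ 1`. -/
noncomputable def npq (α : ℝ) (i : ℕ) : ℤ := ⌈(ncq α (i - 1))⁻¹⌉

/-- Convergent denominators: `q₀ = 1`, `q₁ = a₁`, `q_{i+2} = a_{i+2} q_{i+1} − q_i`. -/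
noncomputable def nq (α : ℝ) : ℕ → ℤ
  | 0 => 1
  | 1 => npq α 1
  | i + 2 => npq α (i + 2) * nq α (i + 1) - nq α i

/-- Convergent numerators: `p₀ = 0`, `p₁ = 1`, `p_{i+2} = a_{i+2} p_{i+1} − p_i`. -/
noncomputable def np (α : ℝ) : ℕ → ℤ
  | 0 => 0
  | 1 => 1
  | i + 2 => npq α (i + 2) * np α (i + 1) - np α i

/-- `Dk α k = α₁α₂⋯α_k` (with `Dk α 0 = 1`). -/
noncomputable def Dk (α : ℝ) (k : ℕ) : ℝ := ∏ j ∈ Finset.range k, ncq α j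

/-- Davenport remainders: `drem α β i = β_{i+1}`, so `drem α β 0 = β₁ = β` and
`β_{i+1} = β_i/α_i − ⌊β_i/α_i⌋`. -/
noncomputable def drem (α β : ℝ) : ℕ → ℝ
  | 0 => β
  | i + 1 => Int.fract (drem α β i / ncq α i)

/-- Davenport coefficients: `db α β i = b_i = ⌊β_i/α_i⌋` for `i ≥ 1`. -/
noncomputable def db (α β : ℝ) (i : ℕ) : ℤ := ⌊drem α β (i - 1) / ncq α (i - 1)⌋

/-- `Qn α β n = Σ_{k=1}^n b_k q_{k−1}`. -/
noncomputable def Qn (α β : ℝ) (n : ℕ) : ℤ :=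
  ∑ k ∈ Finset.Icc 1 n, db α β k * nq α (k - 1)

/-- `Q′_n`. -/
noncomputable def Qn' (α β : ℝ) (n : ℕ) : ℤ :=
  if Qn α β n < nq α n - nq α (n - 1) then Qn α β n + nq α (n - 1)
  else Qn α β n + nq α (n - 1) - nq α n

/-- `λ_n(β) = Q_n D_n β_{n+1}`. -/
noncomputable def lam (α β : ℝ) (n : ℕ) : ℝ :=
  (Qn α β n : ℝ) * Dk α n * drem α β n

/-- `ρ_n(β)`. -/
noncomputable def rho (α β : ℝ) (n : ℕ) : ℝ :=
  if Qn α β n < nq α n - nq α (n - 1)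
  then (Qn' α β n : ℝ) * Dk α n * (1 - drem α β n)
  else (Qn' α β n : ℝ) * Dk α n * (1 - ncq α n - drem α β n)

/-- Reversed quotients: `ᾱ₀ = 0`, `ᾱ_i = 1/(a_i − ᾱ_{i−1})`. -/
noncomputable def rq (α : ℝ) : ℕ → ℝ
  | 0 => 0
  | i + 1 => ((npq α (i + 1) : ℝ) - rq α i)⁻¹

section NegativeContinuedFraction

variable {α : ℝ}

lemma ncq_irrational_mem (hirr : Irrational α) (h0 : 0 < α) (h1 : α < 1) (n : ℕ) :
    Irrational (ncq α n) ∧ 0 < ncq α n ∧ ncq α n < 1 := by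
  induction n with
  | zero => exact ⟨hirr, h0, h1⟩
  | succ n ih =>
    obtain ⟨hi, _, _⟩ := ih
    have hirr' : Irrational (ncq α (n + 1)) := (irrational_inv_iff.2 hi).intCast_sub _
    refine ⟨hirr', lt_of_le_of_ne ?_ fun h => hirr'.ne_zero h.symm, ?_⟩
    · exact sub_nonneg.2 (Int.le_ceil _)
    · have := Int.ceil_lt_add_one (ncq α n)⁻¹
      change (⌈(ncq α n)⁻¹⌉ : ℝ) - (ncq α n)⁻¹ < 1
      linarith

lemma ncq_mul_ncq_succ (hirr : Irrational α) (h0 : 0 < α) (h1 : α < 1) (n : ℕ) :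
    ncq α n * ncq α (n + 1) = npq α (n + 1) * ncq α n - 1 := by
  have h := (ncq_irrational_mem hirr h0 h1 n).2.1.ne'
  change ncq α n * ((npq α (n + 1) : ℝ) - (ncq α n)⁻¹) = _
  field_simp

lemma two_le_npq (hirr : Irrational α) (h0 : 0 < α) (h1 : α < 1) (n : ℕ) :
    2 ≤ npq α (n + 1) := by
  obtain ⟨-, hp, hl⟩ := ncq_irrational_mem hirr h0 h1 n
  have : (1 : ℤ) < npq α (n + 1) :=
    Int.lt_ceil.2 (by simpa using (one_lt_inv₀ hp).2 hl)
  omega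

lemma nq_pos_and_lt_succ (hirr : Irrational α) (h0 : 0 < α) (h1 : α < 1) (n : ℕ) :
    0 < nq α n ∧ nq α n < nq α (n + 1) := by
  induction n with
  | zero =>
    have := two_le_npq hirr h0 h1 0
    exact ⟨one_pos, lt_of_lt_of_le one_lt_two this⟩
  | succ n ih =>
    have := two_le_npq hirr h0 h1 (n + 1)
    refine ⟨by omega, ?_⟩
    change _ < npq α (n + 2) * nq α (n + 1) - nq α n
    nlinarith

lemma Dk_succ (n : ℕ) : Dk α (n + 1) = Dk α n * ncq α n := Finset.prod_range_succ _ _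

lemma Dk_pos (hirr : Irrational α) (h0 : 0 < α) (h1 : α < 1) (n : ℕ) : 0 < Dk α n :=
  Finset.prod_pos fun i _ => (ncq_irrational_mem hirr h0 h1 i).2.1

lemma Dk_succ_lt (hirr : Irrational α) (h0 : 0 < α) (h1 : α < 1) (n : ℕ) :
    Dk α (n + 1) < Dk α n := by
  rw [Dk_succ]
  exact mul_lt_of_lt_one_right (Dk_pos hirr h0 h1 n) (ncq_irrational_mem hirr h0 h1 n).2.2

lemma Dk_succ_succ (hirr : Irrational α) (h0 : 0 < α) (h1 : α < 1) (n : ℕ) :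
    Dk α (n + 2) = npq α (n + 1) * Dk α (n + 1) - Dk α n := by
  rw [Dk_succ, Dk_succ, mul_assoc, ncq_mul_ncq_succ hirr h0 h1]
  ring

lemma nq_mul_sub_np (hirr : Irrational α) (h0 : 0 < α) (h1 : α < 1) (n : ℕ) :
    nq α n * α - np α n = Dk α (n + 1) ∧
      nq α (n + 1) * α - np α (n + 1) = Dk α (n + 2) := by
  induction n with
  | zero =>
    have h := Dk_succ_succ hirr h0 h1 0
    simp only [Dk, Finset.prod_range_succ, Finset.prod_range_zero, ncq] at h ⊢
    simp only [nq, np]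
    constructor
    · simp
    · rw [h]; simp
  | succ n ih =>
    refine ⟨ih.2, ?_⟩
    rw [Dk_succ_succ hirr h0 h1, ← ih.1, ← ih.2]
    change ((npq α (n + 2) * nq α (n + 1) - nq α n : ℤ) : ℝ) * α
      - ((npq α (n + 2) * np α (n + 1) - np α n : ℤ) : ℝ) = _
    push_cast
    ring

lemma np_mul_nq_sub (α : ℝ) (n : ℕ) :
    np α (n + 1) * nq α n - np α n * nq α (n + 1) = 1 := by
  induction n with
  | zero => simp [np, nq]
  | succ n ih =>
    change (npq α (n + 2) * np α (n + 1) - np α n) * nq α (n + 1)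
      - np α (n + 1) * (npq α (n + 2) * nq α (n + 1) - nq α n) = 1
    linear_combination ih

lemma nq_mul_Dk_sub (hirr : Irrational α) (h0 : 0 < α) (h1 : α < 1) (n : ℕ) :
    nq α (n + 1) * Dk α (n + 1) - nq α n * Dk α (n + 2) = 1 := by
  have h := np_mul_nq_sub α n
  have hdet : (np α (n + 1) : ℝ) * nq α n - np α n * nq α (n + 1) = 1 := by exact_mod_cast h
  rw [← (nq_mul_sub_np hirr h0 h1 n).1, ← (nq_mul_sub_np hirr h0 h1 n).2]
  linear_combination hdet

/-- Every integer pair is an integer combination of two consecutive convergents. -/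
lemma exists_convergent_coordinates (hirr : Irrational α) (h0 : 0 < α) (h1 : α < 1)
    (n : ℕ) (r p : ℤ) :
    ∃ u v : ℤ, r = u * nq α n + v * nq α (n + 1) ∧
      r * α - p = u * Dk α (n + 1) + v * Dk α (n + 2) := by
  have h := np_mul_nq_sub α n
  have h' : (np α (n + 1) : ℝ) * nq α n - np α n * nq α (n + 1) = 1 := by exact_mod_cast h
  refine ⟨r * np α (n + 1) - p * nq α (n + 1), p * nq α n - r * np α n, ?_, ?_⟩
  · linear_combination -r * h
  · rw [← (nq_mul_sub_np hirr h0 h1 n).1, ← (nq_mul_sub_np hirr h0 h1 n).2]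
    push_cast
    linear_combination (p - r * α) * h'

lemma frequently_three_le_npq (hirr : Irrational α) (h0 : 0 < α) (h1 : α < 1) :
    ∃ᶠ n in atTop, 3 ≤ npq α (n + 1) := by
  intro hev
  obtain ⟨N, hN⟩ := eventually_atTop.1 hev
  have hlin : ∀ k : ℕ, Dk α (N + k) = Dk α N - k * (Dk α N - Dk α (N + 1)) ∧
      Dk α (N + k + 1) = Dk α N - (k + 1) * (Dk α N - Dk α (N + 1)) := by
    intro k
    induction k with
    | zero => constructor <;> simp
    | succ k ih =>
      have h2 : npq α (N + k + 1) = 2 := by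
        have := hN (N + k) (by omega)
        have := two_le_npq hirr h0 h1 (N + k)
        omega
      have := Dk_succ_succ hirr h0 h1 (N + k)
      rw [h2, ih.1, ih.2] at this
      constructor
      · rw [← add_assoc, ih.2]; push_cast; ring
      · rw [← add_assoc, this]; push_cast; ring
  have hd := sub_pos.2 (Dk_succ_lt hirr h0 h1 N)
  obtain ⟨k, hk⟩ := Archimedean.arch (Dk α N) hd
  have := Dk_pos hirr h0 h1 (N + k)
  rw [(hlin k).1] at this
  rw [nsmul_eq_mul] at hk
  linarith

lemma frequently_ncq_lt_half (hirr : Irrational α) (h0 : 0 < α) (h1 : α < 1) :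
    ∃ᶠ n in atTop, ncq α n < 1 / 2 := by
  refine (frequently_three_le_npq hirr h0 h1).mono fun n hn => ?_
  have hn' : (3 : ℝ) ≤ npq α (n + 1) := by exact_mod_cast hn
  have h := ncq_mul_ncq_succ hirr h0 h1 n
  have hp := (ncq_irrational_mem hirr h0 h1 n).2.1
  have hl := (ncq_irrational_mem hirr h0 h1 (n + 1)).2.2
  nlinarith

lemma tendsto_Dk_zero (hirr : Irrational α) (h0 : 0 < α) (h1 : α < 1) :
    Tendsto (Dk α) atTop (nhds 0) := by
  have hanti : Antitone (Dk α) := antitone_nat_of_succ_le fun n => (Dk_succ_lt hirr h0 h1 n).le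
  have hbdd : BddBelow (Set.range (Dk α)) :=
    ⟨0, by rintro _ ⟨n, rfl⟩; exact (Dk_pos hirr h0 h1 n).le⟩
  have hlim := tendsto_atTop_ciInf hanti hbdd
  set L := ⨅ n, Dk α n with hL
  have hL0 : 0 ≤ L := le_ciInf fun n => (Dk_pos hirr h0 h1 n).le
  rcases hL0.eq_or_lt with h | h
  · rwa [← h] at hlim
  · have hev : ∀ᶠ n in atTop, Dk α n < 2 * L := hlim.eventually_lt_const (by linarith)
    obtain ⟨n, hn1, hn2⟩ := ((frequently_ncq_lt_half hirr h0 h1).and_eventually hev).exists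
    have h3 : L ≤ Dk α (n + 1) := ciInf_le hbdd _
    rw [Dk_succ] at h3
    nlinarith [Dk_pos hirr h0 h1 n]

lemma frequently_nq_mul_Dk_lt_two (hirr : Irrational α) (h0 : 0 < α) (h1 : α < 1) :
    ∃ᶠ n in atTop, nq α n * Dk α n < 2 := by
  refine ((frequently_ncq_lt_half hirr h0 h1).and_eventually (eventually_ge_atTop 1)).mono ?_
  rintro n ⟨hn, hn1⟩
  obtain ⟨m, rfl⟩ := Nat.exists_eq_add_of_le' hn1
  have h := nq_mul_Dk_sub hirr h0 h1 m
  rw [Dk_succ (m + 1)] at h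
  have hD := Dk_pos hirr h0 h1 (m + 1)
  obtain ⟨hq, hlt⟩ := nq_pos_and_lt_succ hirr h0 h1 m
  have hq' : (0 : ℝ) < nq α m := by exact_mod_cast hq
  have hlt' : (nq α m : ℝ) < nq α (m + 1) := by exact_mod_cast hlt
  have e1 : nq α m * (Dk α (m + 1) * ncq α (m + 1)) ≤ nq α m * (Dk α (m + 1) * (1 / 2)) := by
    gcongr
  have e2 : nq α m * Dk α (m + 1) < nq α (m + 1) * Dk α (m + 1) := by gcongr
  linarith

/-- Among `0 < r < q_{n+1}`, the smallest positive value of `rα - p` is at least `D_{n+1}`. -/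
lemma Dk_le_of_pos (hirr : Irrational α) (h0 : 0 < α) (h1 : α < 1) {n : ℕ} {r p : ℤ}
    (hr0 : 0 ≤ r) (hr : r < nq α (n + 1)) (hpos : 0 < r * α - p) :
    Dk α (n + 1) ≤ r * α - p := by
  obtain ⟨u, v, hr', hv⟩ := exists_convergent_coordinates hirr h0 h1 n r p
  obtain ⟨hq, hlt⟩ := nq_pos_and_lt_succ hirr h0 h1 n
  have hD := Dk_pos hirr h0 h1 (n + 2)
  have hDlt : Dk α (n + 2) < Dk α (n + 1) := Dk_succ_lt hirr h0 h1 (n + 1)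
  rw [hv] at hpos ⊢
  by_cases hv1 : 1 ≤ v
  · exfalso
    have hu : u ≤ -1 := by
      by_contra hu
      have : 0 ≤ u := by omega
      nlinarith
    have huv : 1 ≤ u + v := by
      by_contra hc
      have hc' : (v : ℝ) ≤ -u := by exact_mod_cast (by omega : v ≤ -u)
      have hu' : (u : ℝ) ≤ -1 := by exact_mod_cast hu
      nlinarith
    nlinarith
  · have huv : 1 ≤ u + v := by
      by_contra hc
      have hc' : (u : ℝ) ≤ -v := by exact_mod_cast (by omega : u ≤ -v)
      have hv' : (v : ℝ) ≤ 0 := by exact_mod_cast (by omega : v ≤ 0)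
      rcases (by omega : v = 0 ∨ v ≤ -1) with h | h
      · subst h
        push_cast at hpos hc'
        nlinarith
      · nlinarith
    have huv' : (1 : ℝ) - v ≤ u := by exact_mod_cast (by omega : 1 - v ≤ u)
    have hv' : (v : ℝ) ≤ 0 := by exact_mod_cast (by omega : v ≤ 0)
    nlinarith

/-- If `rα - p` is negative and larger than `-(D_{n+1} - (j-1) D_{n+2})`, then
`r ≥ j q_{n+1} - q_n`. -/
lemma le_of_neg_of_lt (hirr : Irrational α) (h0 : 0 < α) (h1 : α < 1) {n : ℕ} {r p j : ℤ}
    (hr0 : 0 ≤ r) (hneg : r * α - p < 0)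
    (hlt : -(Dk α (n + 1) - (j - 1) * Dk α (n + 2)) < r * α - p) :
    j * nq α (n + 1) - nq α n ≤ r := by
  obtain ⟨u, v, hr', hv⟩ := exists_convergent_coordinates hirr h0 h1 n r p
  obtain ⟨hq, hqlt⟩ := nq_pos_and_lt_succ hirr h0 h1 n
  have hD := Dk_pos hirr h0 h1 (n + 2)
  have hDlt : Dk α (n + 2) < Dk α (n + 1) := Dk_succ_lt hirr h0 h1 (n + 1)
  rw [hv] at hneg hlt
  have hu : u ≤ -1 := by
    by_contra hu
    have hu0 : 0 ≤ u := by omega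
    have hu0' : (0 : ℝ) ≤ u := by exact_mod_cast hu0
    have hvu : v + u ≤ -1 := by
      by_contra hc
      have hc' : (-u : ℝ) ≤ v := by exact_mod_cast (by omega : -u ≤ v)
      nlinarith
    nlinarith
  have huv : j - 1 ≤ u + v := by
    by_contra hc
    have hc' : (v : ℝ) ≤ j - 2 - u := by exact_mod_cast (by omega : v ≤ j - 2 - u)
    have hu' : (u : ℝ) ≤ -1 := by exact_mod_cast hu
    nlinarith
  nlinarith

end NegativeContinuedFraction

section DavenportExpansion

variable {α β : ℝ}

lemma drem_nonneg_and_lt_one (hβ0 : 0 < β) (hβ1 : β < 1) (n : ℕ) :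
    0 ≤ drem α β n ∧ drem α β n < 1 := by
  cases n with
  | zero => exact ⟨hβ0.le, hβ1⟩
  | succ n => exact ⟨Int.fract_nonneg _, Int.fract_lt_one _⟩

lemma drem_eq (hirr : Irrational α) (h0 : 0 < α) (h1 : α < 1) (β : ℝ) (n : ℕ) :
    drem α β n = (db α β (n + 1) + drem α β (n + 1)) * ncq α n := by
  have h := (ncq_irrational_mem hirr h0 h1 n).2.1.ne'
  change _ = ((⌊drem α β n / ncq α n⌋ : ℝ) + Int.fract (drem α β n / ncq α n)) * ncq α n
  rw [Int.floor_add_fract]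
  field_simp

lemma db_nonneg (hirr : Irrational α) (h0 : 0 < α) (h1 : α < 1) (hβ0 : 0 < β) (hβ1 : β < 1)
    (n : ℕ) : 0 ≤ db α β (n + 1) :=
  Int.floor_nonneg.2 (div_nonneg (drem_nonneg_and_lt_one hβ0 hβ1 n).1
    (ncq_irrational_mem hirr h0 h1 n).2.1.le)

lemma db_le (hirr : Irrational α) (h0 : 0 < α) (h1 : α < 1) (hβ0 : 0 < β) (hβ1 : β < 1)
    (n : ℕ) : db α β (n + 1) ≤ npq α (n + 1) - 1 := by
  by_contra hc
  have hc' : (npq α (n + 1) : ℝ) ≤ db α β (n + 1) := by exact_mod_cast (by omega)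
  have h := drem_eq hirr h0 h1 β n
  have h2 := ncq_mul_ncq_succ hirr h0 h1 n
  have h3 := drem_nonneg_and_lt_one (α := α) hβ0 hβ1 n
  have h4 := drem_nonneg_and_lt_one (α := α) hβ0 hβ1 (n + 1)
  have h5 := (ncq_irrational_mem hirr h0 h1 n).2.1
  have h6 := (ncq_irrational_mem hirr h0 h1 (n + 1)).2.1
  nlinarith [mul_pos h5 h6]

lemma Qn_succ (α β : ℝ) (n : ℕ) : Qn α β (n + 1) = Qn α β n + db α β (n + 1) * nq α n := by
  simp [Qn, Finset.sum_Icc_succ_top]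

lemma Dk_mul_drem (hirr : Irrational α) (h0 : 0 < α) (h1 : α < 1) (β : ℝ) (n : ℕ) :
    Dk α n * drem α β n = Dk α (n + 1) * (db α β (n + 1) + drem α β (n + 1)) := by
  rw [drem_eq hirr h0 h1, Dk_succ]
  ring

lemma exists_Qn_mul_sub (hirr : Irrational α) (h0 : 0 < α) (h1 : α < 1) (β : ℝ) (n : ℕ) :
    ∃ P : ℤ, Qn α β n * α - P - β = -(Dk α n * drem α β n) := by
  induction n with
  | zero => exact ⟨0, by simp [Qn, Dk, drem]⟩
  | succ n ih =>
    obtain ⟨P, hP⟩ := ih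
    refine ⟨P + db α β (n + 1) * np α n, ?_⟩
    rw [Dk_mul_drem hirr h0 h1] at hP
    have := (nq_mul_sub_np hirr h0 h1 n).1
    rw [Qn_succ]
    push_cast
    linear_combination hP + db α β (n + 1) * this

lemma drem_succ_lt_of_db_eq (hirr : Irrational α) (h0 : 0 < α) (h1 : α < 1)
    (hβ0 : 0 < β) (hβ1 : β < 1) {n : ℕ} (h : db α β (n + 1) = npq α (n + 1) - 1) :
    1 - ncq α n ≤ drem α β n ∧ drem α β (n + 1) < 1 - ncq α (n + 1) := by
  have e := drem_eq hirr h0 h1 β n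
  rw [h] at e
  push_cast at e
  have h2 := ncq_mul_ncq_succ hirr h0 h1 n
  have h3 := drem_nonneg_and_lt_one (α := α) hβ0 hβ1 n
  have h4 := drem_nonneg_and_lt_one (α := α) hβ0 hβ1 (n + 1)
  have h5 := (ncq_irrational_mem hirr h0 h1 n).2.1
  have h6 := (ncq_irrational_mem hirr h0 h1 (n + 1)).2.1
  constructor
  · nlinarith [mul_pos h5 h6]
  · by_contra hc
    nlinarith

lemma le_drem_of_db_eq (hirr : Irrational α) (h0 : 0 < α) (h1 : α < 1) {n : ℕ}
    (h : db α β (n + 1) = npq α (n + 1) - 2) :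
    1 - ncq α (n + 1) ≤ drem α β (n + 1) → 1 - ncq α n ≤ drem α β n := by
  intro hle
  have e := drem_eq hirr h0 h1 β n
  rw [h] at e
  push_cast at e
  have h2 := ncq_mul_ncq_succ hirr h0 h1 n
  have h5 := (ncq_irrational_mem hirr h0 h1 n).2.1
  nlinarith

/-- The admissibility of Davenport digits, in terms of the partial sums `Q_n`. -/
lemma Qn_bounds (hirr : Irrational α) (h0 : 0 < α) (h1 : α < 1) (hβ0 : 0 < β) (hβ1 : β < 1)
    (n : ℕ) : 0 ≤ Qn α β (n + 1) ∧ Qn α β (n + 1) < nq α (n + 1) ∧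
      (1 - ncq α (n + 1) ≤ drem α β (n + 1) → Qn α β (n + 1) < nq α (n + 1) - nq α n) := by
  induction n with
  | zero =>
    have e : Qn α β (0 + 1) = db α β (0 + 1) := by rw [Qn_succ]; simp [Qn, nq]
    have e1 : nq α (0 + 1) = npq α (0 + 1) := rfl
    have e0 : nq α 0 = 1 := rfl
    have hb := db_nonneg hirr h0 h1 hβ0 hβ1 0
    have hb' := db_le hirr h0 h1 hβ0 hβ1 0
    rw [e, e1, e0]
    refine ⟨hb, by omega, fun hle => lt_of_le_of_ne hb' fun h => ?_⟩
    have := (drem_succ_lt_of_db_eq hirr h0 h1 hβ0 hβ1 h).2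
    linarith
  | succ n ih =>
    obtain ⟨ih0, ih1, ih2⟩ := ih
    have hb := db_nonneg hirr h0 h1 hβ0 hβ1 (n + 1)
    have hb' := db_le hirr h0 h1 hβ0 hβ1 (n + 1)
    have eq : nq α (n + 1 + 1) = npq α (n + 1 + 1) * nq α (n + 1) - nq α n := rfl
    obtain ⟨hq, hlt⟩ := nq_pos_and_lt_succ hirr h0 h1 n
    rw [Qn_succ, eq]
    refine ⟨add_nonneg ih0 (mul_nonneg hb (by omega)), ?_, fun hle => ?_⟩
    · rcases hb'.eq_or_lt with h | h
      · have := ih2 (drem_succ_lt_of_db_eq hirr h0 h1 hβ0 hβ1 h).1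
        rw [h]; linarith
      · nlinarith
    · have hne : db α β (n + 1 + 1) ≠ npq α (n + 1 + 1) - 1 := fun h => by
        have := (drem_succ_lt_of_db_eq hirr h0 h1 hβ0 hβ1 h).2
        linarith
      rcases (by omega : db α β (n + 1 + 1) = npq α (n + 1 + 1) - 2 ∨
          db α β (n + 1 + 1) ≤ npq α (n + 1 + 1) - 3) with h | h
      · have := ih2 (le_drem_of_db_eq hirr h0 h1 h hle)
        rw [h]; linarith
      · nlinarith

/-- The error `Q'_n α - β` modulo one of the best approximation from above at level `n`. -/
noncomputable def upperRem (α β : ℝ) (n : ℕ) : ℝ :=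
  if Qn α β n < nq α n - nq α (n - 1) then Dk α n * (1 - drem α β n)
  else Dk α n * (1 - ncq α n - drem α β n)

lemma rho_eq (α β : ℝ) (n : ℕ) : rho α β n = Qn' α β n * upperRem α β n := by
  unfold rho upperRem
  split_ifs <;> ring

lemma upperRem_pos_and_le (hirr : Irrational α) (h0 : 0 < α) (h1 : α < 1)
    (hβ0 : 0 < β) (hβ1 : β < 1) (n : ℕ) :
    0 < upperRem α β (n + 1) ∧ upperRem α β (n + 1) ≤ Dk α (n + 1) := by
  have hD := Dk_pos hirr h0 h1 (n + 1)
  have hα := (ncq_irrational_mem hirr h0 h1 (n + 1)).2.1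
  obtain ⟨hd0, hd1⟩ := drem_nonneg_and_lt_one (α := α) hβ0 hβ1 (n + 1)
  have hb := (Qn_bounds hirr h0 h1 hβ0 hβ1 n).2.2
  unfold upperRem
  rw [Nat.add_sub_cancel]
  split_ifs with h
  · exact ⟨mul_pos hD (by linarith), mul_le_of_le_one_right hD.le (by linarith)⟩
  · have : drem α β (n + 1) < 1 - ncq α (n + 1) := by
      by_contra hc
      exact h (hb (not_lt.1 hc))
    exact ⟨mul_pos hD (by linarith), mul_le_of_le_one_right hD.le (by linarith)⟩

lemma Qn'_bounds (hirr : Irrational α) (h0 : 0 < α) (h1 : α < 1)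
    (hβ0 : 0 < β) (hβ1 : β < 1) (n : ℕ) :
    0 ≤ Qn' α β (n + 1) ∧ Qn' α β (n + 1) < nq α (n + 1) := by
  obtain ⟨hQ0, hQ1, -⟩ := Qn_bounds hirr h0 h1 hβ0 hβ1 n
  obtain ⟨hq, hlt⟩ := nq_pos_and_lt_succ hirr h0 h1 n
  unfold Qn'
  rw [Nat.add_sub_cancel]
  split_ifs with h <;> constructor <;> omega

lemma exists_Qn'_mul_sub (hirr : Irrational α) (h0 : 0 < α) (h1 : α < 1) (β : ℝ) (n : ℕ) :
    ∃ P : ℤ, Qn' α β (n + 1) * α - P - β = upperRem α β (n + 1) := by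
  obtain ⟨P, hP⟩ := exists_Qn_mul_sub hirr h0 h1 β (n + 1)
  obtain ⟨e1, e2⟩ := nq_mul_sub_np hirr h0 h1 n
  rw [Dk_succ (n + 1)] at e2
  unfold Qn' upperRem
  rw [Nat.add_sub_cancel]
  split_ifs
  · refine ⟨P + np α n, ?_⟩
    push_cast
    linear_combination hP + e1
  · refine ⟨P + np α n - np α (n + 1), ?_⟩
    push_cast
    linear_combination hP + e1 - e2

lemma Qn'_succ (hirr : Irrational α) (h0 : 0 < α) (h1 : α < 1)
    (hβ0 : 0 < β) (hβ1 : β < 1) (n : ℕ) :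
    Qn' α β (n + 2) = Qn' α β (n + 1) ∨
      ∃ j : ℤ, Qn' α β (n + 2) = Qn' α β (n + 1) + (j * nq α (n + 1) - nq α n) ∧
        upperRem α β (n + 1) = upperRem α β (n + 2) + (Dk α (n + 1) - j * Dk α (n + 2)) := by
  obtain ⟨hQ0, hQ1, -⟩ := Qn_bounds hirr h0 h1 hβ0 hβ1 n
  obtain ⟨hq, hlt⟩ := nq_pos_and_lt_succ hirr h0 h1 n
  have hb := db_nonneg hirr h0 h1 hβ0 hβ1 (n + 1)
  have hb' := db_le hirr h0 h1 hβ0 hβ1 (n + 1)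
  have hQ := (Qn_bounds hirr h0 h1 hβ0 hβ1 (n + 1)).2.1
  have eq : nq α (n + 2) = npq α (n + 2) * nq α (n + 1) - nq α n := rfl
  have eQ : Qn α β (n + 2) = _ := Qn_succ α β (n + 1)
  have eD := Dk_mul_drem hirr h0 h1 β (n + 1)
  have eα := Dk_succ (α := α) (n + 1)
  norm_num only [add_assoc] at hb hb' hQ eQ eD eα
  unfold Qn' upperRem
  rw [Nat.add_sub_cancel, show n + 2 - 1 = n + 1 from rfl]
  by_cases hc2 : Qn α β (n + 2) < nq α (n + 2) - nq α (n + 1)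
  · right
    by_cases hc1 : Qn α β (n + 1) < nq α (n + 1) - nq α n
    · refine ⟨db α β (n + 2) + 1, ?_, ?_⟩
      · rw [if_pos hc1, if_pos hc2, eQ]; ring
      · rw [if_pos hc1, if_pos hc2]; push_cast; linear_combination -eD
    · refine ⟨db α β (n + 2) + 2, ?_, ?_⟩
      · rw [if_neg hc1, if_pos hc2, eQ]; ring
      · rw [if_neg hc1, if_pos hc2]; push_cast; linear_combination -eD + eα
  · left
    by_cases hc1 : Qn α β (n + 1) < nq α (n + 1) - nq α n
    · have : db α β (n + 2) = npq α (n + 2) - 1 := by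
        by_contra hne
        have : db α β (n + 2) ≤ npq α (n + 2) - 2 := by omega
        refine hc2 ?_
        rw [eQ, eq]
        nlinarith
      rw [if_pos hc1, if_neg hc2, eQ, eq, this]; ring
    · have : db α β (n + 2) = npq α (n + 2) - 2 := by
        refine le_antisymm ?_ ?_
        · by_contra hne
          have h : db α β (n + 2) = npq α (n + 2) - 1 := by omega
          rw [eQ, eq, h] at hQ
          refine hc1 ?_
          linarith
        · by_contra hne
          have : db α β (n + 2) ≤ npq α (n + 2) - 3 := by omega
          refine hc2 ?_
          rw [eQ, eq]
          nlinarith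
      rw [if_neg hc1, if_neg hc2, eQ, eq, this]; ring

/-- An approximation from below with denominator between `Q_{n+1}` and `Q_{n+2}` is no better than
the worse of the two bounding ones. -/
lemma le_mul_of_lower (hirr : Irrational α) (h0 : 0 < α) (h1 : α < 1)
    (hβ0 : 0 < β) (hβ1 : β < 1) {n : ℕ} {q p : ℤ} {c : ℝ}
    (hq1 : Qn α β (n + 1) ≤ q) (hq2 : q < Qn α β (n + 2)) (hx : q * α - p - β < 0)
    (hc1 : c ≤ lam α β (n + 1)) (hc2 : c ≤ lam α β (n + 2)) :
    c ≤ q * |q * α - p - β| := by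
  rw [abs_of_neg hx]
  obtain ⟨P, hP⟩ := exists_Qn_mul_sub hirr h0 h1 β (n + 1)
  have hQ0 := (Qn_bounds hirr h0 h1 hβ0 hβ1 n).1
  obtain ⟨-, hs⟩ := nq_pos_and_lt_succ hirr h0 h1 n
  have hs0 := (nq_pos_and_lt_succ hirr h0 h1 (n + 1)).1
  have eQ : Qn α β (n + 2) = _ := Qn_succ α β (n + 1)
  have eD := Dk_mul_drem hirr h0 h1 β (n + 1)
  have hD := Dk_pos hirr h0 h1 (n + 2)
  have hD1 := Dk_pos hirr h0 h1 (n + 1)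
  have hd := drem_nonneg_and_lt_one (α := α) hβ0 hβ1 (n + 1)
  have hd' := drem_nonneg_and_lt_one (α := α) hβ0 hβ1 (n + 2)
  have es := (nq_mul_sub_np hirr h0 h1 n).2
  norm_num only [add_assoc] at eQ eD
  have hdiv := Int.emod_add_mul_ediv (q - Qn α β (n + 1)) (nq α (n + 1))
  have hr0 := Int.emod_nonneg (q - Qn α β (n + 1)) hs0.ne'
  have hr1 := Int.emod_lt_of_pos (q - Qn α β (n + 1)) hs0
  have hj0 : 0 ≤ (q - Qn α β (n + 1)) / nq α (n + 1) :=
    Int.ediv_nonneg (by omega) hs0.le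
  have hjb : (q - Qn α β (n + 1)) / nq α (n + 1) < db α β (n + 2) :=
    Int.ediv_lt_of_lt_mul hs0 (by omega)
  set j := (q - Qn α β (n + 1)) / nq α (n + 1)
  set r := (q - Qn α β (n + 1)) % nq α (n + 1)
  set b := db α β (n + 2)
  have hdiv' : (r : ℝ) + nq α (n + 1) * j = q - Qn α β (n + 1) := by exact_mod_cast hdiv
  have hj0' : (0 : ℝ) ≤ j := by exact_mod_cast hj0
  have hjb' : (j : ℝ) < b := by exact_mod_cast hjb
  have hr0' : (0 : ℝ) ≤ r := by exact_mod_cast hr0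
  have hs0' : (0 : ℝ) < nq α (n + 1) := by exact_mod_cast hs0
  have hQ0' : (0 : ℝ) ≤ Qn α β (n + 1) := by exact_mod_cast hQ0
  have hy0 : 0 ≤ Dk α (n + 1) * drem α β (n + 1) - j * Dk α (n + 2) := by
    rw [eD]; nlinarith [mul_nonneg hD.le hd'.1]
  have hxy : Dk α (n + 1) * drem α β (n + 1) - j * Dk α (n + 2) ≤ -(q * α - p - β) := by
    by_contra! hlt
    have e : (r : ℝ) * α - ((p - P - j * np α (n + 1) : ℤ) : ℝ) =
        (Dk α (n + 1) * drem α β (n + 1) - j * Dk α (n + 2)) + (q * α - p - β) := by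
      push_cast
      linear_combination α * hdiv' - hP - j * es
    have := Dk_le_of_pos hirr h0 h1 (p := p - P - j * np α (n + 1)) hr0 hr1
      (by rw [e]; linarith)
    rw [e] at this
    nlinarith
  have hmid : c ≤ (Qn α β (n + 1) + j * nq α (n + 1)) *
      (Dk α (n + 1) * drem α β (n + 1) - j * Dk α (n + 2)) := by
    have hb0 : (0 : ℝ) < b := by linarith
    unfold lam at hc1 hc2
    rw [mul_assoc] at hc1 hc2
    have eD' : Dk α (n + 2) * drem α β (n + 2) =
        Dk α (n + 1) * drem α β (n + 1) - b * Dk α (n + 2) := by linear_combination -eD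
    rw [eD', eQ] at hc2
    push_cast at hc2
    have key := mul_nonneg (mul_nonneg hj0' (sub_nonneg.2 hjb'.le))
      (mul_nonneg (mul_nonneg hs0'.le hD.le) hb0.le)
    have k1 := mul_le_mul_of_nonneg_left hc1 (sub_nonneg.2 hjb'.le)
    have k2 := mul_le_mul_of_nonneg_left hc2 hj0'
    refine le_of_mul_le_mul_left ?_ hb0
    linarith
  refine hmid.trans (mul_le_mul ?_ hxy hy0 ?_) <;> nlinarith

/-- An approximation from above with denominator between `Q'_{n+1}` and `Q'_{n+2}` is no better
than the first of the two bounding ones. -/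
lemma le_mul_of_upper (hirr : Irrational α) (h0 : 0 < α) (h1 : α < 1)
    (hβ0 : 0 < β) (hβ1 : β < 1) {n : ℕ} {q p : ℤ} {c : ℝ}
    (hq1 : Qn' α β (n + 1) ≤ q) (hq2 : q < Qn' α β (n + 2)) (hx : 0 < q * α - p - β)
    (hc : c ≤ rho α β (n + 1)) :
    c ≤ q * |q * α - p - β| := by
  rw [abs_of_pos hx]
  rw [rho_eq] at hc
  have hQ0 := (Qn'_bounds hirr h0 h1 hβ0 hβ1 n).1
  have hQ0' : (0 : ℝ) ≤ Qn' α β (n + 1) := by exact_mod_cast hQ0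
  have hq1' : (Qn' α β (n + 1) : ℝ) ≤ q := by exact_mod_cast hq1
  have hy := (upperRem_pos_and_le hirr h0 h1 hβ0 hβ1 n).1
  have hy' : _ ∧ upperRem α β (n + 2) ≤ _ := upperRem_pos_and_le hirr h0 h1 hβ0 hβ1 (n + 1)
  obtain ⟨P, hP⟩ := exists_Qn'_mul_sub hirr h0 h1 β n
  refine hc.trans (mul_le_mul hq1' ?_ hy.le (by linarith))
  by_contra! hlt
  rcases Qn'_succ hirr h0 h1 hβ0 hβ1 n with h | ⟨j, hj, hyj⟩
  · omega
  · have e : ((q - Qn' α β (n + 1) : ℤ) : ℝ) * α - ((p - P : ℤ) : ℝ) =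
        (q * α - p - β) - upperRem α β (n + 1) := by
      push_cast
      linear_combination -hP
    have := le_of_neg_of_lt hirr h0 h1 (n := n) (r := q - Qn' α β (n + 1)) (p := p - P) (j := j)
      (by omega) (by rw [e]; linarith)
      (by rw [e]; have := hy'.2; norm_num only [add_assoc] at this; linarith)
    omega

end DavenportExpansion

section Liminf

lemma nint_nonneg (x : ℝ) : 0 ≤ nint x := abs_nonneg _

lemma nint_le (x : ℝ) (p : ℤ) : nint x ≤ |x - p| := round_le x p

lemma nint_pos {α β : ℝ} (hβ0 : 0 < β) (hβ1 : β < 1)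
    (hβ : ¬ ∃ q p : ℤ, 1 ≤ q ∧ β = q * α - p) (q : ℕ) : 0 < nint (q * α - β) := by
  refine abs_pos.2 fun h => ?_
  rcases Nat.eq_zero_or_pos q with rfl | hq
  · generalize round (((0 : ℕ) : ℝ) * α - β) = m at h
    have h1 : (-1 : ℝ) < m := by push_cast at h; linarith
    have h2 : (m : ℝ) < 0 := by push_cast at h; linarith
    have h1' : -1 < m := by exact_mod_cast h1
    have h2' : m < 0 := by exact_mod_cast h2
    omega
  · exact hβ ⟨q, round (q * α - β), by exact_mod_cast hq, by push_cast; linarith⟩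

/-- Integers whose multiples of `α` approach a `β` off the forward orbit tend to infinity. -/
lemma tendsto_toNat_atTop {α β : ℝ} (hβ0 : 0 < β) (hβ1 : β < 1)
    (hβ : ¬ ∃ q p : ℤ, 1 ≤ q ∧ β = q * α - p) {A : ℕ → ℤ} (hA : ∀ n, 0 ≤ A (n + 1))
    {y : ℕ → ℝ} (hy : ∀ n, ∃ p : ℤ, |A (n + 1) * α - p - β| ≤ y (n + 1))
    (hy0 : Tendsto y atTop (nhds 0)) : Tendsto (fun n => (A n).toNat) atTop atTop := by
  refine tendsto_atTop.2 fun B => ?_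
  have hev : ∀ᶠ n in atTop, ∀ q ∈ Finset.range B, y n < nint (q * α - β) :=
    (Finset.eventually_all _).2 fun q _ => hy0.eventually_lt_const (nint_pos hβ0 hβ1 hβ q)
  filter_upwards [hev, eventually_ge_atTop 1] with n hn hn1
  obtain ⟨m, rfl⟩ := Nat.exists_eq_add_of_le' hn1
  by_contra! hlt
  obtain ⟨p, hp⟩ := hy m
  have h2 := hn _ (Finset.mem_range.2 hlt)
  have h3 := nint_le ((A (m + 1)).toNat * α - β) p
  have h4 : (((A (m + 1)).toNat : ℕ) : ℝ) = A (m + 1) := by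
    exact_mod_cast Int.toNat_of_nonneg (hA m)
  rw [h4] at h2 h3
  rw [sub_right_comm] at hp
  linarith

lemma isBoundedUnder_ge_Mplus (α β : ℝ) :
    IsBoundedUnder (· ≥ ·) atTop (fun q : ℕ => (q : ℝ) * nint (q * α - β)) :=
  isBoundedUnder_of ⟨0, fun _ => mul_nonneg (Nat.cast_nonneg _) (nint_nonneg _)⟩

lemma exists_between_consecutive {A : ℕ → ℕ} (hA : Tendsto A atTop atTop) {N q : ℕ}
    (hq : A N ≤ q) : ∃ n, N ≤ n ∧ A n ≤ q ∧ q < A (n + 1) := by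
  by_contra! hc
  have hle : ∀ k, A (N + k) ≤ q := fun k => by
    induction k with
    | zero => exact hq
    | succ k ih => exact hc (N + k) (Nat.le_add_right N k) ih
  obtain ⟨n, hn, hn'⟩ := ((hA.eventually_gt_atTop q).and (eventually_ge_atTop N)).exists
  obtain ⟨k, rfl⟩ := Nat.exists_eq_add_of_le hn'
  exact absurd (hle k) (by omega)

lemma mul_nint_toNat_le {α β y : ℝ} {a : ℤ} (ha : 0 ≤ a) (hy : ∃ p : ℤ, |a * α - p - β| ≤ y) :
    (a.toNat : ℝ) * nint (a.toNat * α - β) ≤ a * y := by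
  obtain ⟨p, hp⟩ := hy
  have h : ((a.toNat : ℕ) : ℝ) = a := by exact_mod_cast Int.toNat_of_nonneg ha
  rw [h]
  rw [sub_right_comm] at hp
  have ha_real : (0 : ℝ) ≤ a := by exact_mod_cast ha
  exact mul_le_mul_of_nonneg_left ((nint_le _ p).trans hp) ha_real

/-- Any sequence of approximations bounds the approximation constant from above. -/
lemma Mplus_le_liminf {α β : ℝ} {A : ℕ → ℤ} (hA : ∀ n, 0 ≤ A (n + 1)) {y : ℕ → ℝ}
    (hy : ∀ n, ∃ p : ℤ, |A (n + 1) * α - p - β| ≤ y (n + 1))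
    (hlim : Tendsto (fun n => (A n).toNat) atTop atTop) {C : ℝ}
    (hC : ∃ᶠ n in atTop, A n * y n ≤ C) :
    Mplus α β ≤ liminf (fun n => A n * y n) atTop := by
  refine le_of_forall_lt fun c hc => ?_
  obtain ⟨c', hcc', hc'⟩ := exists_between hc
  refine hcc'.trans_le (le_liminf_of_le (IsCoboundedUnder.of_frequently_le hC) ?_)
  have hev := eventually_lt_of_lt_liminf hc' (isBoundedUnder_ge_Mplus α β)
  filter_upwards [hlim.eventually hev, eventually_ge_atTop 1] with n hn hn1
  obtain ⟨m, rfl⟩ := Nat.exists_eq_add_of_le' hn1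
  exact hn.le.trans (mul_nint_toNat_le (hA m) (hy m))

end Liminf

/-- If `0 < α < 1` is irrational, `0 < β < 1`, and `β ≠ qα − p` for all
integers `q ≥ 1` and `p`, then `M₊(α,β) = min(liminf λ_n(β), liminf ρ_n(β))`. -/
theorem stmt3 (α : ℝ) (hirr : Irrational α) (h0 : 0 < α) (h1 : α < 1)
    (β : ℝ) (hβ0 : 0 < β) (hβ1 : β < 1)
    (hβ : ¬ ∃ q p : ℤ, 1 ≤ q ∧ β = q * α - p) :
    Mplus α β =
      min (Filter.liminf (fun n : ℕ => lam α β n) Filter.atTop)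
        (Filter.liminf (fun n : ℕ => rho α β n) Filter.atTop) := by
  have hD0 := tendsto_Dk_zero hirr h0 h1
  have hlam_eq : (fun n => lam α β n) = fun n => Qn α β n * (Dk α n * drem α β n) :=
    funext fun n => mul_assoc _ _ _
  have hrho_eq : (fun n => rho α β n) = fun n => Qn' α β n * upperRem α β n :=
    funext (rho_eq α β)
  have hQ0 : ∀ n, 0 ≤ Qn α β (n + 1) := fun n => (Qn_bounds hirr h0 h1 hβ0 hβ1 n).1
  have hQ0' : ∀ n, 0 ≤ Qn' α β (n + 1) := fun n => (Qn'_bounds hirr h0 h1 hβ0 hβ1 n).1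
  have hd := drem_nonneg_and_lt_one (α := α) hβ0 hβ1
  have hDd : ∀ n, 0 ≤ Dk α n * drem α β n ∧ Dk α n * drem α β n ≤ Dk α n := fun n =>
    have hD := (Dk_pos hirr h0 h1 n).le
    ⟨mul_nonneg hD (hd n).1, mul_le_of_le_one_right hD (hd n).2.le⟩
  have hu := upperRem_pos_and_le hirr h0 h1 hβ0 hβ1
  have hy : ∀ n, ∃ p : ℤ, |Qn α β (n + 1) * α - p - β| ≤ Dk α (n + 1) * drem α β (n + 1) :=
    fun n => by
      obtain ⟨P, hP⟩ := exists_Qn_mul_sub hirr h0 h1 β (n + 1)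
      exact ⟨P, by rw [hP, abs_neg, abs_of_nonneg (hDd _).1]⟩
  have hy' : ∀ n, ∃ p : ℤ, |Qn' α β (n + 1) * α - p - β| ≤ upperRem α β (n + 1) := fun n => by
    obtain ⟨P, hP⟩ := exists_Qn'_mul_sub hirr h0 h1 β n
    exact ⟨P, by rw [hP, abs_of_pos (hu n).1]⟩
  have hlim : Tendsto (fun n => (Qn α β n).toNat) atTop atTop :=
    tendsto_toNat_atTop hβ0 hβ1 hβ hQ0
      (fun n => (hy n).imp fun p hp => hp.trans (hDd _).2) hD0
  have hlim' : Tendsto (fun n => (Qn' α β n).toNat) atTop atTop :=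
    tendsto_toNat_atTop hβ0 hβ1 hβ hQ0'
      (fun n => (hy' n).imp fun p hp => hp.trans (hu n).2) hD0
  have hfreq : ∀ {A : ℕ → ℤ} {y : ℕ → ℝ}, (∀ n, A (n + 1) < nq α (n + 1)) →
      (∀ n, 0 ≤ y (n + 1) ∧ y (n + 1) ≤ Dk α (n + 1)) → ∃ᶠ n in atTop, A n * y n ≤ 2 := by
    intro A y hA hy
    refine ((frequently_nq_mul_Dk_lt_two hirr h0 h1).and_eventually
      (eventually_ge_atTop 1)).mono ?_
    rintro n ⟨hn, hn1⟩
    obtain ⟨m, rfl⟩ := Nat.exists_eq_add_of_le' hn1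
    have hA' : (A (m + 1) : ℝ) ≤ nq α (m + 1) := by exact_mod_cast (hA m).le
    have hq : (0 : ℝ) ≤ nq α (m + 1) := by
      exact_mod_cast (nq_pos_and_lt_succ hirr h0 h1 (m + 1)).1.le
    exact (mul_le_mul hA' (hy m).2 (hy m).1 hq).trans hn.le
  have hfl := hfreq (y := fun n => Dk α n * drem α β n)
    (fun n => (Qn_bounds hirr h0 h1 hβ0 hβ1 n).2.1) (fun n => hDd (n + 1))
  have hfr := hfreq (y := upperRem α β) (fun n => (Qn'_bounds hirr h0 h1 hβ0 hβ1 n).2)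
    (fun n => ⟨(hu n).1.le, (hu n).2⟩)
  apply le_antisymm
  · rw [hlam_eq, hrho_eq]
    exact le_min (Mplus_le_liminf hQ0 hy hlim hfl) (Mplus_le_liminf hQ0' hy' hlim' hfr)
  · refine le_of_forall_lt fun c hc => ?_
    obtain ⟨c', hcc', hc'⟩ := exists_between hc
    obtain ⟨hcl, hcr⟩ := lt_min_iff.1 hc'
    have hnonneg : ∀ {A : ℕ → ℤ} {y : ℕ → ℝ}, (∀ n, 0 ≤ A (n + 1)) → (∀ n, 0 ≤ y (n + 1)) →
        IsBoundedUnder (· ≥ ·) atTop fun n => A n * y n := fun hA hy =>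
      isBoundedUnder_of_eventually_ge (a := 0) <| by
        filter_upwards [eventually_ge_atTop 1] with n hn1
        obtain ⟨m, rfl⟩ := Nat.exists_eq_add_of_le' hn1
        exact mul_nonneg (by exact_mod_cast hA m) (hy m)
    have hbl : IsBoundedUnder (· ≥ ·) atTop fun n => lam α β n := by
      rw [hlam_eq]; exact hnonneg hQ0 fun n => (hDd (n + 1)).1
    have hbr : IsBoundedUnder (· ≥ ·) atTop fun n => rho α β n := by
      rw [hrho_eq]; exact hnonneg hQ0' fun n => (hu n).1.le
    obtain ⟨N, hN⟩ := eventually_atTop.1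
      ((eventually_lt_of_lt_liminf hcl hbl).and (eventually_lt_of_lt_liminf hcr hbr))
    have hco : ∃ᶠ q : ℕ in atTop, (q : ℝ) * nint (q * α - β) ≤ 2 := by
      refine hlim.frequently ((hfl.and_eventually (eventually_ge_atTop 1)).mono ?_)
      rintro n ⟨hn, hn1⟩
      obtain ⟨m, rfl⟩ := Nat.exists_eq_add_of_le' hn1
      exact (mul_nint_toNat_le (hQ0 m) (hy m)).trans hn
    refine hcc'.trans_le (le_liminf_of_le (IsCoboundedUnder.of_frequently_le hco) ?_)
    filter_upwards [eventually_ge_atTop (Qn α β (N + 1)).toNat,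
      eventually_ge_atTop (Qn' α β (N + 1)).toNat] with q hq hq'
    have hpos := nint_pos hβ0 hβ1 hβ q
    have hnint : nint (q * α - β) = |((q : ℤ) : ℝ) * α - round (q * α - β) - β| := by
      rw [nint, sub_right_comm]; rfl
    rw [hnint] at hpos ⊢
    rcases lt_or_gt_of_ne (abs_pos.1 hpos) with h | h
    · obtain ⟨n, hn, hn1, hn2⟩ := exists_between_consecutive hlim hq
      obtain ⟨m, rfl⟩ := Nat.exists_eq_add_of_le' (by omega : 1 ≤ n)
      exact le_mul_of_lower hirr h0 h1 hβ0 hβ1 (Int.toNat_le.1 hn1) (Int.lt_toNat.1 hn2) h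
        (hN _ (by omega)).1.le (hN _ (by omega)).1.le
    · obtain ⟨n, hn, hn1, hn2⟩ := exists_between_consecutive hlim' hq'
      obtain ⟨m, rfl⟩ := Nat.exists_eq_add_of_le' (by omega : 1 ≤ n)
      exact le_mul_of_upper hirr h0 h1 hβ0 hβ1 (Int.toNat_le.1 hn1) (Int.lt_toNat.1 hn2) h
        (hN _ (by omega)).2.le
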